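/- arXiv:1511.02618 — 2 statements merged into one kernel-verified Lean document; each statement's English description precedes it below -/
import Mathlib

section
/- Let Ω ⊆ ℝⁿ be a bounded open set satisfying the quantitative cone condition with parameters c > 0 and r > 0. Let 0 < β ≤ 1, C_β > 0, and let u : closure(Ω) → ℝ be (β, C_β)-Hölder continuous. Set M := sup_{x ∈ closure(Ω)} |λ(u(x))| and suppose M > 0. Then ∫_Ω |λ(u(x))| dx ≥ (c/2) · min(r, (M/(2·C_β))^{1/β})ⁿ · M. -/
open MeasureTheory

/-- The penalisation function `λ(t) = max(t-1, 0) + min(t+1, 0)`. -/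
noncomputable def lam (t : ℝ) : ℝ := max (t - 1) 0 + min (t + 1) 0

/-- `u` is `(β, Cβ)`-Hölder continuous on `A ⊆ ℝⁿ`. -/
def IsHolderOn {n : ℕ} (β Cβ : ℝ) (A : Set (EuclideanSpace ℝ (Fin n)))
    (u : EuclideanSpace ℝ (Fin n) → ℝ) : Prop :=
  ∀ x ∈ A, ∀ y ∈ A, |u x - u y| ≤ Cβ * ‖x - y‖ ^ β

/-- `Ω` satisfies the quantitative cone condition with parameters `c, r`: every ball
`B(x, R)` centred at a point of `closure Ω` with `0 < R ≤ r` contains a measurable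
subset of `Ω` of Lebesgue measure at least `c·Rⁿ`. -/
def ConeCondition {n : ℕ} (Ω : Set (EuclideanSpace ℝ (Fin n))) (c r : ℝ) : Prop :=
  ∀ x ∈ closure Ω, ∀ R : ℝ, 0 < R → R ≤ r →
    ∃ S : Set (EuclideanSpace ℝ (Fin n)), MeasurableSet S ∧
      S ⊆ Ω ∩ Metric.ball x R ∧ c * R ^ n ≤ (volume S).toReal

lemma lam_eq (t : ℝ) : lam t = t - max (-1) (min t 1) := by
  unfold lam
  grind

lemma abs_lam_sub_lam_le (s t : ℝ) : |lam s - lam t| ≤ |s - t| := by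
  rw [lam_eq, lam_eq]
  grind

lemma IsHolderOn.continuousOn {n : ℕ} {β Cβ : ℝ} {A : Set (EuclideanSpace ℝ (Fin n))}
    {u : EuclideanSpace ℝ (Fin n) → ℝ} (hu : IsHolderOn β Cβ A u) (hβ : 0 < β) :
    ContinuousOn u A := by
  intro x hx
  have hcont : Continuous fun y : EuclideanSpace ℝ (Fin n) => Cβ * ‖y - x‖ ^ β :=
    continuous_const.mul ((continuous_id.sub continuous_const).norm.rpow_const
      fun _ => Or.inr hβ.le)
  have hlim : Filter.Tendsto (fun y => Cβ * ‖y - x‖ ^ β) (nhdsWithin x A) (nhds 0) := by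
    simpa [Real.zero_rpow hβ.ne'] using (hcont.tendsto x).mono_left nhdsWithin_le_nhds
  refine tendsto_iff_dist_tendsto_zero.2 (squeeze_zero' ?_ ?_ hlim)
  · exact Filter.Eventually.of_forall fun _ => dist_nonneg
  · filter_upwards [self_mem_nhdsWithin] with y hy
    simpa [Real.dist_eq] using hu y hy x hx

lemma IsHolderOn.abs_lam {n : ℕ} {β Cβ : ℝ} {A : Set (EuclideanSpace ℝ (Fin n))}
    {u : EuclideanSpace ℝ (Fin n) → ℝ} (hu : IsHolderOn β Cβ A u) :
    IsHolderOn β Cβ A fun x => |lam (u x)| := fun x hx y hy =>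
  (abs_abs_sub_abs_le _ _).trans ((abs_lam_sub_lam_le _ _).trans (hu x hx y hy))

/-- Quantitative lower bound for the `L¹` norm of the constraint violation in terms of
its supremum `M` over `closure Ω`:
`∫_Ω |λ(u)| ≥ (c/2) · min(r, (M/(2 Cβ))^(1/β))ⁿ · M`. -/
theorem l1_lower_bound_of_sup {n : ℕ} (Ω : Set (EuclideanSpace ℝ (Fin n)))
    (hΩo : IsOpen Ω) (hΩb : Bornology.IsBounded Ω)
    (c r : ℝ) (hc : 0 < c) (hr : 0 < r) (hcone : ConeCondition Ω c r)
    (β Cβ : ℝ) (hβ : 0 < β) (hβ1 : β ≤ 1) (hCβ : 0 < Cβ)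
    (u : EuclideanSpace ℝ (Fin n) → ℝ) (hu : IsHolderOn β Cβ (closure Ω) u)
    (M : ℝ) (hM : M = sSup ((fun x => |lam (u x)|) '' closure Ω)) (hMpos : 0 < M) :
    c / 2 * min r ((M / (2 * Cβ)) ^ (1 / β)) ^ n * M ≤ ∫ x in Ω, |lam (u x)| := by
  have hf := hu.abs_lam
  have hfc := hf.continuousOn hβ
  have hcpt : IsCompact (closure Ω) := hΩb.isCompact_closure
  have hne : (closure Ω).Nonempty := by
    by_contra h
    rw [Set.not_nonempty_iff_eq_empty] at h
    simp [h] at hM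
    exact hMpos.ne' hM
  obtain ⟨x₀, hx₀, hx₀M⟩ := hcpt.exists_sSup_image_eq hne hfc
  rw [← hM] at hx₀M
  have hq : 0 < M / (2 * Cβ) := by positivity
  set R := min r ((M / (2 * Cβ)) ^ (1 / β)) with hR
  have hRpos : 0 < R := lt_min hr (Real.rpow_pos_of_pos hq _)
  have hRβ : Cβ * R ^ β ≤ M / 2 := by
    have h : R ^ β ≤ M / (2 * Cβ) := by
      calc R ^ β ≤ ((M / (2 * Cβ)) ^ (1 / β)) ^ β :=
            Real.rpow_le_rpow hRpos.le (min_le_right _ _) hβ.le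
        _ = M / (2 * Cβ) := by
            rw [← Real.rpow_mul hq.le, one_div_mul_cancel hβ.ne', Real.rpow_one]
    calc Cβ * R ^ β ≤ Cβ * (M / (2 * Cβ)) := by gcongr
      _ = M / 2 := by field_simp
  obtain ⟨S, hSm, hSsub, hSvol⟩ := hcone x₀ hx₀ R hRpos (min_le_left _ _)
  have hSΩ : S ⊆ Ω := fun x hx => (hSsub hx).1
  have hlow : ∀ x ∈ S, M / 2 ≤ |lam (u x)| := by
    intro x hx
    have hdist : ‖x₀ - x‖ ≤ R := by
      rw [← dist_eq_norm, dist_comm]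
      exact (Metric.mem_ball.1 (hSsub hx).2).le
    have hosc : |lam (u x₀)| - |lam (u x)| ≤ Cβ * ‖x₀ - x‖ ^ β :=
      (le_abs_self _).trans (hf x₀ hx₀ x (subset_closure (hSΩ hx)))
    have hpow : Cβ * ‖x₀ - x‖ ^ β ≤ Cβ * R ^ β := by gcongr
    linarith
  have hint : IntegrableOn (fun x => |lam (u x)|) Ω :=
    (hfc.integrableOn_compact hcpt).mono_set subset_closure
  have hSfin : volume S ≠ ⊤ := (hΩb.subset hSΩ).measure_lt_top.ne
  calc c / 2 * R ^ n * M = M / 2 * (c * R ^ n) := by ring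
    _ ≤ M / 2 * volume.real S := mul_le_mul_of_nonneg_left hSvol (by positivity)
    _ ≤ ∫ x in S, |lam (u x)| :=
        setIntegral_ge_of_const_le_real hSm hSfin hlow (hint.mono_set hSΩ)
    _ ≤ ∫ x in Ω, |lam (u x)| :=
        setIntegral_mono_set hint (Filter.Eventually.of_forall fun _ => abs_nonneg _)
          (Filter.Eventually.of_forall hSΩ)
end

section
/- Let m be a positive integer, let w₁, …, w_m ≥ 0 with w₁ + ⋯ + w_m = 1, and let a₁, …, a_m ∈ ℝ. Then |∑_{i=1}^m w_i·λ(a_i)| ≥ |λ(∑_{i=1}^m w_i·a_i)|. -/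
theorem sub_one_le_lam (t : ℝ) : t - 1 ≤ lam t := by
  unfold lam
  grind

theorem lam_le_add_one (t : ℝ) : lam t ≤ t + 1 := by
  unfold lam
  grind

theorem abs_lam_le_abs {t y : ℝ} (h₁ : t - 1 ≤ y) (h₂ : y ≤ t + 1) : |lam t| ≤ |y| := by
  unfold lam
  grind

/-- For a convex combination with weights `w` summing to `1`,
`|∑ wᵢ·λ(aᵢ)| ≥ |λ(∑ wᵢ·aᵢ)|`. -/
theorem abs_lam_convex_combination (m : ℕ) (hm : 0 < m)
    (w : Fin m → ℝ) (hw : ∀ i, 0 ≤ w i) (hsum : ∑ i, w i = 1)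
    (a : Fin m → ℝ) :
    |lam (∑ i, w i * a i)| ≤ |∑ i, w i * lam (a i)| := by
  apply abs_lam_le_abs
  · calc ∑ i, w i * a i - 1 = ∑ i, w i * (a i - 1) := by
          simp only [mul_sub, mul_one, Finset.sum_sub_distrib, hsum]
      _ ≤ ∑ i, w i * lam (a i) :=
          Finset.sum_le_sum fun i _ => mul_le_mul_of_nonneg_left (sub_one_le_lam _) (hw i)
  · calc ∑ i, w i * lam (a i) ≤ ∑ i, w i * (a i + 1) :=
          Finset.sum_le_sum fun i _ => mul_le_mul_of_nonneg_left (lam_le_add_one _) (hw i)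
      _ = ∑ i, w i * a i + 1 := by
          simp only [mul_add, mul_one, Finset.sum_add_distrib, hsum]
end
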